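/- For every β > 0 there exists an integer n̄ = n̄(β) such that for every n ≥ n̄ and every integer k with 1 ≤ k ≤ n, |C_{n,k} − C(1 − k/n)| < β. -/

import Mathlib

open scoped BigOperators

noncomputable section

/-- Output alphabet of the binary deletion channel with `n` input bits:
a length `k ≤ n` together with a binary string of that length. -/
abbrev DelOut (n : ℕ) := Σ k : Fin (n + 1), (Fin (k : ℕ) → Bool)

/-- The subsequence of `x` indexed by `S` (taken in increasing order),
as an element of `DelOut n`. -/
def restrictSub {n : ℕ} (x : Fin n → Bool) (S : Finset (Fin n)) : DelOut n :=
  ⟨⟨S.card, Nat.lt_succ_of_le (by simpa using Finset.card_le_univ S)⟩,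
   fun i => x (S.orderEmbOfFin rfl i)⟩

/-- Transition probability of the binary deletion channel `W_n^d`: each input bit is
deleted independently with probability `d`. -/
def delW {n : ℕ} (d : ℝ) (x : Fin n → Bool) (y : DelOut n) : ℝ :=
  ∑ S : Finset (Fin n),
    if restrictSub x S = y then (1 - d) ^ S.card * d ^ (n - S.card) else 0

/-- Transition probability of the exact deletion channel `W_{n,k}`, which keeps exactly `k`
of the `n` input bits, the kept positions being a uniformly random `k`-subset; `k`-subsets
are identified with strictly monotone maps `Fin k → Fin n`. -/
def exactW {n k : ℕ} (x : Fin n → Bool) (y : Fin k → Bool) : ℝ :=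
  ((Finset.univ.filter fun f : Fin k → Fin n => StrictMono f ∧ x ∘ f = y).card : ℝ) /
    (n.choose k : ℝ)

/-- `p` is a probability distribution on the finite alphabet `α`. -/
def IsDist {α : Type*} [Fintype α] (p : α → ℝ) : Prop :=
  (∀ a, 0 ≤ p a) ∧ ∑ a, p a = 1

/-- Base-2 mutual information `I(X;Y)` between the input `X ~ p` and the output `Y`
of the channel with transition matrix `W`. -/
def mutualInfo {α β : Type*} [Fintype α] [Fintype β] (p : α → ℝ) (W : α → β → ℝ) : ℝ :=
  ∑ x, ∑ y, p x * W x y * Real.logb 2 (W x y / ∑ x', p x' * W x' y)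

/-- `C_n(d) = (1/n) · sup_p I(X ; W_n^d(X))`. -/
def Cn (n : ℕ) (d : ℝ) : ℝ :=
  (1 / (n : ℝ)) * ⨆ p : {p : (Fin n → Bool) → ℝ // IsDist p}, mutualInfo p.1 (delW d)

/-- `C_{n,k} = (1/n) · sup_p I(X ; W_{n,k}(X))`. -/
def Cnk (n k : ℕ) : ℝ :=
  (1 / (n : ℝ)) * ⨆ p : {p : (Fin n → Bool) → ℝ // IsDist p},
    mutualInfo p.1 (exactW (n := n) (k := k))

/-- Capacity of the binary deletion channel: `C(d) = inf_{n ≥ 1} C_n(d)`. -/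
def C (d : ℝ) : ℝ := ⨅ n : {m : ℕ // 1 ≤ m}, Cn n d

/-- Every row of `W` is a probability distribution. -/
def IsChannel {α β : Type*} [Fintype β] (W : α → β → ℝ) : Prop := ∀ x, IsDist (W x)

open Classical in
/-- The channel that applies `f` to the output of `W`. -/
def pushChannel {α β γ : Type*} [Fintype β] (f : β → γ) (W : α → β → ℝ) (x : α) (z : γ) : ℝ :=
  ∑ y, if f y = z then W x y else 0

lemma div_mul_self_le {a : ℝ} (ha : 0 ≤ a) (b : ℝ) : a / b * b ≤ a := by
  rcases eq_or_ne b 0 with rfl | hb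
  · simpa using ha
  · rw [div_mul_cancel₀ _ hb]

lemma sum_pushChannel_mul {α β γ : Type*} [Fintype β] [Fintype γ] (f : β → γ) (W : α → β → ℝ)
    (x : α) (g : γ → ℝ) :
    ∑ z, pushChannel f W x z * g z = ∑ y, W x y * g (f y) := by
  classical
  simp only [pushChannel, Finset.sum_mul, ite_mul, zero_mul]
  rw [Finset.sum_comm]
  simp

lemma isChannel_uniform_right {α β : Type*} [Fintype β] {N : ℕ} (hN : 0 < N)
    {W : α → β → ℝ} (hW : IsChannel W) :
    IsChannel (fun x (y : β × Fin N) => W x y.1 / N) := by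
  have hN' : (N : ℝ) ≠ 0 := by exact_mod_cast hN.ne'
  refine fun x => ⟨fun y => div_nonneg ((hW x).1 _) N.cast_nonneg, ?_⟩
  simp only [Fintype.sum_prod_type, Finset.sum_const, Finset.card_univ, Fintype.card_fin,
    nsmul_eq_mul, mul_div_cancel₀ _ hN', (hW x).2]

lemma isChannel_pushChannel {α β γ : Type*} [Fintype β] [Fintype γ]
    {W : α → β → ℝ} (hW : IsChannel W) (f : β → γ) :
    IsChannel (pushChannel f W) := by
  intro x
  refine ⟨fun z => Finset.sum_nonneg fun y _ => ?_, ?_⟩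
  · split_ifs
    exacts [(hW x).1 y, le_rfl]
  · simpa [(hW x).2] using sum_pushChannel_mul f W x (fun _ => 1)

lemma le_pushChannel {α β γ : Type*} [Fintype β]
    {W : α → β → ℝ} (hW : IsChannel W) (f : β → γ) (x : α) (y : β) :
    W x y ≤ pushChannel f W x (f y) := by
  classical
  have h := Finset.single_le_sum (f := fun y' => if f y' = f y then W x y' else 0)
    (fun y' _ => by
      split_ifs
      exacts [(hW x).1 y', le_rfl]) (Finset.mem_univ y)
  rw [if_pos rfl] at h
  exact h

section Information

variable {α β γ : Type*} [Fintype α] [Fintype β] [Fintype γ]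

/-- Output distribution of the channel `W` on input distribution `p`. -/
def outDist (p : α → ℝ) (W : α → β → ℝ) (y : β) : ℝ := ∑ x, p x * W x y

lemma mutualInfo_eq_log (p : α → ℝ) (W : α → β → ℝ) :
    mutualInfo p W =
      (∑ x, ∑ y, p x * W x y * Real.log (W x y / outDist p W y)) / Real.log 2 := by
  simp only [mutualInfo, outDist, Real.logb, Finset.sum_div, mul_div_assoc]

lemma outDist_nonneg {p : α → ℝ} {W : α → β → ℝ} (hp : IsDist p) (hW : IsChannel W) (y : β) :
    0 ≤ outDist p W y :=
  Finset.sum_nonneg fun x _ => mul_nonneg (hp.1 x) ((hW x).1 y)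

lemma le_outDist {p : α → ℝ} {W : α → β → ℝ} (hp : IsDist p) (hW : IsChannel W)
    (x : α) (y : β) : p x * W x y ≤ outDist p W y :=
  Finset.single_le_sum (f := fun x => p x * W x y)
    (fun x _ => mul_nonneg (hp.1 x) ((hW x).1 y)) (Finset.mem_univ x)

lemma sum_sum_joint {p : α → ℝ} {W : α → β → ℝ} (hp : IsDist p) (hW : IsChannel W) :
    ∑ x, ∑ y, p x * W x y = 1 := by
  simp only [← Finset.mul_sum, (hW _).2, mul_one, hp.2]

lemma isDist_outDist {p : α → ℝ} {W : α → β → ℝ} (hp : IsDist p) (hW : IsChannel W) :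
    IsDist (outDist p W) := by
  refine ⟨outDist_nonneg hp hW, ?_⟩
  simp only [outDist]
  rw [Finset.sum_comm, sum_sum_joint hp hW]

lemma mutualInfo_pushChannel_eq_log (p : α → ℝ) (W : α → β → ℝ) (f : β → γ) :
    mutualInfo p (pushChannel f W) = (∑ x, ∑ y, p x * W x y *
      Real.log (pushChannel f W x (f y) / outDist p (pushChannel f W) (f y))) / Real.log 2 := by
  rw [mutualInfo_eq_log]
  congr 1
  refine Finset.sum_congr rfl fun x _ => ?_
  simp only [mul_assoc, ← Finset.mul_sum]
  rw [sum_pushChannel_mul f W x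
    (fun z => Real.log (pushChannel f W x z / outDist p (pushChannel f W) z))]

/-- Data processing inequality for deterministic processing of the output. -/
lemma mutualInfo_pushChannel_le {p : α → ℝ} {W : α → β → ℝ} (hp : IsDist p) (hW : IsChannel W)
    (f : β → γ) : mutualInfo p (pushChannel f W) ≤ mutualInfo p W := by
  have hV := isChannel_pushChannel hW f
  rw [mutualInfo_pushChannel_eq_log, mutualInfo_eq_log]
  refine div_le_div_of_nonneg_right ?_ (Real.log_nonneg (by norm_num))
  set V := pushChannel f W
  have key : ∀ x y, p x * W x y * Real.log (V x (f y) / outDist p V (f y)) ≤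
      p x * W x y * Real.log (W x y / outDist p W y) +
        (outDist p W y / outDist p V (f y) * (p x * V x (f y)) - p x * W x y) := by
    intro x y
    have hq := outDist_nonneg hp hW y
    have hr := outDist_nonneg hp hV (f y)
    have hpx := hp.1 x
    have hVx := (hV x).1 (f y)
    rcases eq_or_lt_of_le (mul_nonneg hpx ((hW x).1 y)) with h0 | h0
    · rw [← h0]
      have := mul_nonneg (div_nonneg hq hr) (mul_nonneg hpx hVx)
      linarith
    · have hp0 : 0 < p x := pos_of_mul_pos_left h0 ((hW x).1 y)
      have hW0 : 0 < W x y := pos_of_mul_pos_right h0 hpx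
      have hV0 : 0 < V x (f y) := hW0.trans_le (le_pushChannel hW f x y)
      have hq0 : 0 < outDist p W y := h0.trans_le (le_outDist hp hW x y)
      have hr0 : 0 < outDist p V (f y) := (mul_pos hp0 hV0).trans_le (le_outDist hp hV x (f y))
      have hlog := Real.log_le_sub_one_of_pos
        (div_pos (div_pos hV0 hr0) (div_pos hW0 hq0))
      rw [Real.log_div (div_pos hV0 hr0).ne' (div_pos hW0 hq0).ne'] at hlog
      have := mul_le_mul_of_nonneg_left hlog h0.le
      have e : outDist p W y / outDist p V (f y) * (p x * V x (f y)) =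
          p x * W x y * (V x (f y) / outDist p V (f y) / (W x y / outDist p W y)) := by
        field_simp
      rw [e]
      linarith
  have h1 : ∑ x, ∑ y, outDist p W y / outDist p V (f y) * (p x * V x (f y)) ≤ 1 := by
    rw [Finset.sum_comm, ← (isDist_outDist hp hW).2]
    refine Finset.sum_le_sum fun y _ => ?_
    rw [← Finset.mul_sum]
    exact div_mul_self_le (outDist_nonneg hp hW _) _
  have h2 := sum_sum_joint hp hW
  have := Finset.sum_le_sum fun x (_ : x ∈ Finset.univ) =>
    Finset.sum_le_sum fun y (_ : y ∈ Finset.univ) => key x y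
  simp only [Finset.sum_add_distrib, Finset.sum_sub_distrib] at this
  linarith

/-- Processing the output by a map with fibers of at most `M` elements loses at most `log₂ M`
bits of information. -/
lemma mutualInfo_le_pushChannel_add {p : α → ℝ} {W : α → β → ℝ} (hp : IsDist p)
    (hW : IsChannel W) (f : β → γ) {M : ℕ} (hM : 0 < M)
    (hf : ∀ z, (f ⁻¹' {z}).ncard ≤ M) :
    mutualInfo p W ≤ mutualInfo p (pushChannel f W) + Real.logb 2 M := by
  classical
  have hV := isChannel_pushChannel hW f
  have hM' : (0 : ℝ) < M := by exact_mod_cast hM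
  rw [mutualInfo_pushChannel_eq_log, mutualInfo_eq_log, Real.logb, ← add_div]
  refine div_le_div_of_nonneg_right ?_ (Real.log_nonneg (by norm_num))
  set V := pushChannel f W
  have key : ∀ x y, p x * W x y * Real.log (W x y / outDist p W y) ≤
      p x * W x y * Real.log (V x (f y) / outDist p V (f y)) +
        (outDist p V (f y) / M / outDist p W y * (p x * W x y) - p x * W x y
          + p x * W x y * Real.log M) := by
    intro x y
    have hpx := hp.1 x
    rcases eq_or_lt_of_le (mul_nonneg hpx ((hW x).1 y)) with h0 | h0
    · rw [← h0]
      simp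
    · have hp0 : 0 < p x := pos_of_mul_pos_left h0 ((hW x).1 y)
      have hW0 : 0 < W x y := pos_of_mul_pos_right h0 hpx
      have hWV := le_pushChannel hW f x y
      have hV0 : 0 < V x (f y) := hW0.trans_le hWV
      have hq0 : 0 < outDist p W y := h0.trans_le (le_outDist hp hW x y)
      have hr0 : 0 < outDist p V (f y) := (mul_pos hp0 hV0).trans_le (le_outDist hp hV x (f y))
      have hlog := Real.log_le_sub_one_of_pos (div_pos (div_pos hr0 hM') hq0)
      rw [Real.log_div (div_pos hr0 hM').ne' hq0.ne', Real.log_div hr0.ne' hM'.ne'] at hlog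
      have hmono := Real.log_le_log hW0 hWV
      have h3 : Real.log (W x y / outDist p W y) ≤
          Real.log (V x (f y) / outDist p V (f y)) +
            (outDist p V (f y) / M / outDist p W y - 1 + Real.log M) := by
        rw [Real.log_div hW0.ne' hq0.ne', Real.log_div hV0.ne' hr0.ne']
        linarith
      have := mul_le_mul_of_nonneg_left h3 h0.le
      linarith
  have h1 : ∑ x, ∑ y, outDist p V (f y) / M / outDist p W y * (p x * W x y) ≤ 1 := by
    rw [Finset.sum_comm]
    calc _ ≤ ∑ y, outDist p V (f y) / M := by
          refine Finset.sum_le_sum fun y _ => ?_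
          rw [← Finset.mul_sum]
          exact div_mul_self_le (div_nonneg (outDist_nonneg hp hV _) hM'.le) _
      _ = ∑ z, ∑ y with f y = z, outDist p V z / M := by
          rw [← Finset.sum_fiberwise Finset.univ f]
          refine Finset.sum_congr rfl fun z _ => Finset.sum_congr rfl fun y hy => ?_
          rw [(Finset.mem_filter.1 hy).2]
      _ ≤ ∑ z, outDist p V z := by
          refine Finset.sum_le_sum fun z _ => ?_
          have hc : ((Finset.univ.filter fun y => f y = z).card : ℝ) ≤ M := by
            have := hf z
            rw [Set.ncard_eq_toFinset_card'] at this
            have e : (f ⁻¹' {z}).toFinset = Finset.univ.filter fun y => f y = z := by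
              ext; simp
            rw [e] at this
            exact_mod_cast this
          rw [Finset.sum_const, nsmul_eq_mul, mul_div_assoc', div_le_iff₀ hM', mul_comm]
          exact mul_le_mul_of_nonneg_left hc (outDist_nonneg hp hV z)
      _ = 1 := (isDist_outDist hp hV).2
  have h2 := sum_sum_joint hp hW
  have := Finset.sum_le_sum fun x (_ : x ∈ Finset.univ) =>
    Finset.sum_le_sum fun y (_ : y ∈ Finset.univ) => key x y
  simp only [Finset.sum_add_distrib, Finset.sum_sub_distrib, ← Finset.sum_mul, h2] at this
  linarith

lemma mutualInfo_of_unique [Unique γ] {p : α → ℝ} {W : α → γ → ℝ} (hp : IsDist p)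
    (hW : IsChannel W) : mutualInfo p W = 0 := by
  have h : ∀ x, W x default = 1 := fun x => by simpa using (hW x).2
  simp [mutualInfo, h, hp.2]

lemma mutualInfo_nonneg {p : α → ℝ} {W : α → β → ℝ} (hp : IsDist p) (hW : IsChannel W) :
    0 ≤ mutualInfo p W := by
  have h := mutualInfo_pushChannel_le hp hW (fun _ => ())
  rwa [mutualInfo_of_unique hp (isChannel_pushChannel hW _)] at h

lemma mutualInfo_le_logb_card [Nonempty β] {p : α → ℝ} {W : α → β → ℝ} (hp : IsDist p)
    (hW : IsChannel W) : mutualInfo p W ≤ Real.logb 2 (Fintype.card β) := by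
  have h := mutualInfo_le_pushChannel_add hp hW (fun _ => ()) (M := Fintype.card β)
    Fintype.card_pos (fun z => by
      rw [← Nat.card_eq_fintype_card]
      exact Set.ncard_le_card _)
  rwa [mutualInfo_of_unique hp (isChannel_pushChannel hW _), zero_add] at h

lemma bddAbove_mutualInfo [Nonempty β] {W : α → β → ℝ} (hW : IsChannel W) :
    BddAbove (Set.range fun p : {p : α → ℝ // IsDist p} => mutualInfo p.1 W) :=
  ⟨_, Set.forall_mem_range.2 fun p => mutualInfo_le_logb_card p.2 hW⟩

lemma nonempty_dist [Nonempty α] : Nonempty {p : α → ℝ // IsDist p} := by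
  classical
  exact ⟨Pi.single (Classical.arbitrary α) 1, fun a => by
    rw [Pi.single_apply]
    split_ifs <;> norm_num, by simp⟩

/-- Appending an independent uniform symbol to the output does not change the information. -/
lemma mutualInfo_uniform_right {N : ℕ} (hN : 0 < N) (p : α → ℝ) (W : α → β → ℝ) :
    mutualInfo p (fun x (y : β × Fin N) => W x y.1 / N) = mutualInfo p W := by
  have hN' : (N : ℝ) ≠ 0 := by exact_mod_cast hN.ne'
  simp only [mutualInfo, Fintype.sum_prod_type, mul_div_assoc', ← Finset.sum_div,
    div_div_div_cancel_right₀ hN']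
  refine Finset.sum_congr rfl fun x _ => Finset.sum_congr rfl fun y _ => ?_
  rw [Finset.sum_const, Finset.card_univ, Fintype.card_fin, nsmul_eq_mul]
  field_simp

end Information

/-- Two channels used side by side. -/
def prodChannel {α₁ α₂ β₁ β₂ : Type*} (W₁ : α₁ → β₁ → ℝ) (W₂ : α₂ → β₂ → ℝ)
    (x : α₁ × α₂) (y : β₁ × β₂) : ℝ :=
  W₁ x.1 y.1 * W₂ x.2 y.2

lemma isChannel_prodChannel {α₁ α₂ β₁ β₂ : Type*} [Fintype β₁] [Fintype β₂]
    {W₁ : α₁ → β₁ → ℝ} {W₂ : α₂ → β₂ → ℝ} (h₁ : IsChannel W₁) (h₂ : IsChannel W₂) :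
    IsChannel (prodChannel W₁ W₂) := by
  refine fun x => ⟨fun y => mul_nonneg ((h₁ _).1 _) ((h₂ _).1 _), ?_⟩
  simp only [prodChannel, Fintype.sum_prod_type, ← Finset.mul_sum, (h₂ _).2, mul_one, (h₁ _).2]

section Product

variable {α₁ α₂ β₁ β₂ : Type*} [Fintype α₁] [Fintype α₂] [Fintype β₁] [Fintype β₂]

lemma isDist_marginal_fst {p : α₁ × α₂ → ℝ} (hp : IsDist p) :
    IsDist (fun a => ∑ b, p (a, b)) :=
  ⟨fun a => Finset.sum_nonneg fun b _ => hp.1 _, by rw [← hp.2, Fintype.sum_prod_type]⟩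

lemma isDist_marginal_snd {p : α₁ × α₂ → ℝ} (hp : IsDist p) :
    IsDist (fun b => ∑ a, p (a, b)) :=
  ⟨fun a => Finset.sum_nonneg fun b _ => hp.1 _, by rw [← hp.2, Fintype.sum_prod_type_right]⟩

lemma isDist_prod {p₁ : α₁ → ℝ} {p₂ : α₂ → ℝ} (h₁ : IsDist p₁) (h₂ : IsDist p₂) :
    IsDist (fun x : α₁ × α₂ => p₁ x.1 * p₂ x.2) := by
  refine ⟨fun x => mul_nonneg (h₁.1 _) (h₂.1 _), ?_⟩
  simp only [Fintype.sum_prod_type, ← Finset.mul_sum, h₂.2, mul_one, h₁.2]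

lemma sum_prodChannel_mul_fst (p : α₁ × α₂ → ℝ) (W₁ : α₁ → β₁ → ℝ) {W₂ : α₂ → β₂ → ℝ}
    (h₂ : IsChannel W₂) (g : α₁ → β₁ → ℝ) :
    ∑ x, ∑ y, p x * prodChannel W₁ W₂ x y * g x.1 y.1 =
      ∑ a, ∑ b, (∑ a', p (a, a')) * W₁ a b * g a b := by
  simp only [prodChannel, Fintype.sum_prod_type]
  refine Finset.sum_congr rfl fun a _ => ?_
  rw [Finset.sum_comm]
  refine Finset.sum_congr rfl fun b _ => ?_
  simp only [Finset.sum_mul]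
  refine Finset.sum_congr rfl fun a' _ => ?_
  calc _ = ∑ b', p (a, a') * W₁ a b * g a b * W₂ a' b' :=
        Finset.sum_congr rfl fun _ _ => by ring
    _ = _ := by rw [← Finset.mul_sum, (h₂ a').2, mul_one]

lemma sum_prodChannel_mul_snd (p : α₁ × α₂ → ℝ) {W₁ : α₁ → β₁ → ℝ} (W₂ : α₂ → β₂ → ℝ)
    (h₁ : IsChannel W₁) (g : α₂ → β₂ → ℝ) :
    ∑ x, ∑ y, p x * prodChannel W₁ W₂ x y * g x.2 y.2 =
      ∑ a, ∑ b, (∑ a', p (a', a)) * W₂ a b * g a b := by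
  simp only [prodChannel, Fintype.sum_prod_type_right]
  refine Finset.sum_congr rfl fun a _ => ?_
  rw [Finset.sum_comm]
  refine Finset.sum_congr rfl fun b _ => ?_
  simp only [Finset.sum_mul]
  refine Finset.sum_congr rfl fun a' _ => ?_
  calc _ = ∑ b', p (a', a) * W₂ a b * g a b * W₁ a' b' :=
        Finset.sum_congr rfl fun _ _ => by ring
    _ = _ := by rw [← Finset.mul_sum, (h₁ a').2, mul_one]

lemma mutualInfo_marginals_eq_log (p : α₁ × α₂ → ℝ) {W₁ : α₁ → β₁ → ℝ} {W₂ : α₂ → β₂ → ℝ}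
    (h₁ : IsChannel W₁) (h₂ : IsChannel W₂) :
    mutualInfo (fun a => ∑ b, p (a, b)) W₁ + mutualInfo (fun b => ∑ a, p (a, b)) W₂ =
      (∑ x, ∑ y, p x * prodChannel W₁ W₂ x y *
        (Real.log (W₁ x.1 y.1 / outDist (fun a => ∑ b, p (a, b)) W₁ y.1) +
          Real.log (W₂ x.2 y.2 / outDist (fun b => ∑ a, p (a, b)) W₂ y.2))) / Real.log 2 := by
  simp only [mul_add, Finset.sum_add_distrib]
  rw [mutualInfo_eq_log, mutualInfo_eq_log,
    sum_prodChannel_mul_fst p W₁ h₂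
      (fun a b => Real.log (W₁ a b / outDist (fun a => ∑ b, p (a, b)) W₁ b)),
    sum_prodChannel_mul_snd p W₂ h₁
      (fun a b => Real.log (W₂ a b / outDist (fun b => ∑ a, p (a, b)) W₂ b)), add_div]

/-- The information through two parallel channels is at most the sum of the individual ones. -/
lemma mutualInfo_prodChannel_le {p : α₁ × α₂ → ℝ} (hp : IsDist p) {W₁ : α₁ → β₁ → ℝ}
    {W₂ : α₂ → β₂ → ℝ} (h₁ : IsChannel W₁) (h₂ : IsChannel W₂) :
    mutualInfo p (prodChannel W₁ W₂) ≤
      mutualInfo (fun a => ∑ b, p (a, b)) W₁ + mutualInfo (fun b => ∑ a, p (a, b)) W₂ := by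
  have hW := isChannel_prodChannel h₁ h₂
  have hp₁ := isDist_marginal_fst hp
  have hp₂ := isDist_marginal_snd hp
  rw [mutualInfo_marginals_eq_log p h₁ h₂, mutualInfo_eq_log]
  refine div_le_div_of_nonneg_right ?_ (Real.log_nonneg (by norm_num))
  set p₁ := fun a => ∑ b, p (a, b)
  set p₂ := fun b => ∑ a, p (a, b)
  set W := prodChannel W₁ W₂
  have key : ∀ x y, p x * W x y * Real.log (W x y / outDist p W y) ≤
      p x * W x y * (Real.log (W₁ x.1 y.1 / outDist p₁ W₁ y.1) +
        Real.log (W₂ x.2 y.2 / outDist p₂ W₂ y.2)) +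
      (outDist p₁ W₁ y.1 * outDist p₂ W₂ y.2 / outDist p W y * (p x * W x y) - p x * W x y) := by
    intro x y
    rcases eq_or_lt_of_le (mul_nonneg (hp.1 x) ((hW x).1 y)) with h0 | h0
    · rw [← h0]
      simp
    · have hpx : 0 < p x := pos_of_mul_pos_left h0 ((hW x).1 y)
      have hWx : 0 < W₁ x.1 y.1 * W₂ x.2 y.2 := pos_of_mul_pos_right h0 (hp.1 x)
      have hW₁ : 0 < W₁ x.1 y.1 := pos_of_mul_pos_left hWx ((h₂ _).1 _)
      have hW₂ : 0 < W₂ x.2 y.2 := pos_of_mul_pos_right hWx ((h₁ _).1 _)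
      have hq : 0 < outDist p W y := h0.trans_le (le_outDist hp hW x y)
      have hp₁x : 0 < p₁ x.1 := hpx.trans_le
        (Finset.single_le_sum (f := fun b => p (x.1, b)) (fun b _ => hp.1 _) (Finset.mem_univ x.2))
      have hp₂x : 0 < p₂ x.2 := hpx.trans_le
        (Finset.single_le_sum (f := fun a => p (a, x.2)) (fun b _ => hp.1 _) (Finset.mem_univ x.1))
      have hq₁ : 0 < outDist p₁ W₁ y.1 := (mul_pos hp₁x hW₁).trans_le (le_outDist hp₁ h₁ _ _)
      have hq₂ : 0 < outDist p₂ W₂ y.2 := (mul_pos hp₂x hW₂).trans_le (le_outDist hp₂ h₂ _ _)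
      have hlog := Real.log_le_sub_one_of_pos (div_pos (mul_pos hq₁ hq₂) hq)
      rw [Real.log_div (mul_pos hq₁ hq₂).ne' hq.ne', Real.log_mul hq₁.ne' hq₂.ne'] at hlog
      have h3 : Real.log (W x y / outDist p W y) ≤
          Real.log (W₁ x.1 y.1 / outDist p₁ W₁ y.1) + Real.log (W₂ x.2 y.2 / outDist p₂ W₂ y.2) +
            (outDist p₁ W₁ y.1 * outDist p₂ W₂ y.2 / outDist p W y - 1) := by
        have hWxy : W x y = W₁ x.1 y.1 * W₂ x.2 y.2 := rfl
        rw [hWxy, Real.log_div hWx.ne' hq.ne', Real.log_mul hW₁.ne' hW₂.ne', Real.log_div hW₁.ne' hq₁.ne',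
          Real.log_div hW₂.ne' hq₂.ne']
        linarith
      have := mul_le_mul_of_nonneg_left h3 h0.le
      linarith
  have hsum : ∑ x, ∑ y, outDist p₁ W₁ y.1 * outDist p₂ W₂ y.2 / outDist p W y * (p x * W x y)
      ≤ 1 := by
    rw [Finset.sum_comm,
      ← (isDist_prod (isDist_outDist hp₁ h₁) (isDist_outDist hp₂ h₂)).2]
    refine Finset.sum_le_sum fun y _ => ?_
    rw [← Finset.mul_sum]
    exact div_mul_self_le (mul_nonneg (outDist_nonneg hp₁ h₁ _) (outDist_nonneg hp₂ h₂ _)) _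
  have h2 := sum_sum_joint hp hW
  have := Finset.sum_le_sum fun x (_ : x ∈ Finset.univ) =>
    Finset.sum_le_sum fun y (_ : y ∈ Finset.univ) => key x y
  simp only [Finset.sum_add_distrib, Finset.sum_sub_distrib] at this
  linarith

/-- For independent inputs, the information through parallel channels adds up. -/
lemma mutualInfo_prodChannel_prod {p₁ : α₁ → ℝ} {p₂ : α₂ → ℝ} (hp₁ : IsDist p₁) (hp₂ : IsDist p₂)
    {W₁ : α₁ → β₁ → ℝ} {W₂ : α₂ → β₂ → ℝ} (h₁ : IsChannel W₁) (h₂ : IsChannel W₂) :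
    mutualInfo (fun x : α₁ × α₂ => p₁ x.1 * p₂ x.2) (prodChannel W₁ W₂) =
      mutualInfo p₁ W₁ + mutualInfo p₂ W₂ := by
  have h := mutualInfo_marginals_eq_log (fun x : α₁ × α₂ => p₁ x.1 * p₂ x.2) h₁ h₂
  simp only [← Finset.mul_sum, ← Finset.sum_mul, hp₁.2, hp₂.2, mul_one, one_mul] at h
  change mutualInfo p₁ W₁ + mutualInfo p₂ W₂ = _ at h
  rw [h, mutualInfo_eq_log]
  congr 1
  refine Finset.sum_congr rfl fun x _ => Finset.sum_congr rfl fun y _ => ?_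
  have hq : outDist (fun x : α₁ × α₂ => p₁ x.1 * p₂ x.2) (prodChannel W₁ W₂) y =
      outDist p₁ W₁ y.1 * outDist p₂ W₂ y.2 := by
    simp only [outDist, prodChannel, Fintype.sum_prod_type, Finset.sum_mul_sum]
    exact Finset.sum_congr rfl fun _ _ => Finset.sum_congr rfl fun _ _ => by ring
  rcases eq_or_lt_of_le (mul_nonneg ((isDist_prod hp₁ hp₂).1 x)
    ((isChannel_prodChannel h₁ h₂ x).1 y)) with h0 | h0
  · rw [← h0]
    simp
  · have hq0 := h0.trans_le (le_outDist (isDist_prod hp₁ hp₂) (isChannel_prodChannel h₁ h₂) x y)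
    have hWx := pos_of_mul_pos_right h0 ((isDist_prod hp₁ hp₂).1 x)
    rw [hq] at hq0 ⊢
    simp only [prodChannel] at hWx ⊢
    have hW₁ := left_ne_zero_of_mul hWx.ne'
    have hW₂ := right_ne_zero_of_mul hWx.ne'
    have hq₁ := left_ne_zero_of_mul hq0.ne'
    have hq₂ := right_ne_zero_of_mul hq0.ne'
    rw [mul_div_mul_comm, Real.log_mul (div_ne_zero hW₁ hq₁) (div_ne_zero hW₂ hq₂)]

lemma mutualInfo_comp_equiv (e : α₁ ≃ α₂) (p : α₂ → ℝ) (W : α₂ → β₁ → ℝ) :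
    mutualInfo (fun x => p (e x)) (fun x => W (e x)) = mutualInfo p W := by
  have h : ∀ y, ∑ x, p (e x) * W (e x) y = ∑ x, p x * W x y := fun y =>
    Equiv.sum_comp e (fun x => p x * W x y)
  simp only [mutualInfo, h]
  exact Equiv.sum_comp e fun x => ∑ y, p x * W x y * Real.logb 2 (W x y / ∑ x', p x' * W x' y)

lemma isDist_comp_equiv (e : α₁ ≃ α₂) {p : α₂ → ℝ} (hp : IsDist p) :
    IsDist fun x => p (e x) :=
  ⟨fun x => hp.1 _, by rw [Equiv.sum_comp e p, hp.2]⟩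

end Product

section Exact

variable {n k : ℕ}

lemma card_image_strictMono {f : Fin k → Fin n} (hf : StrictMono f) :
    (Finset.univ.image f).card = k := by
  rw [Finset.card_image_of_injective _ hf.injective, Finset.card_univ, Fintype.card_fin]

lemma orderEmbOfFin_image {f : Fin k → Fin n} (hf : StrictMono f)
    (h : (Finset.univ.image f).card = k) : ⇑((Finset.univ.image f).orderEmbOfFin h) = f :=
  (Finset.orderEmbOfFin_unique h
    (fun i => Finset.mem_image_of_mem f (Finset.mem_univ i)) hf).symm

lemma restrictSub_eq_iff (x : Fin n → Bool) (S : Finset (Fin n)) (j : Fin (n + 1))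
    (y : Fin (j : ℕ) → Bool) :
    restrictSub x S = ⟨j, y⟩ ↔ ∃ h : S.card = j, x ∘ S.orderEmbOfFin h = y := by
  obtain ⟨j, hj⟩ := j
  constructor
  · intro h
    obtain ⟨h1, h2⟩ := Sigma.mk.inj_iff.1 h
    obtain rfl : S.card = j := congrArg Fin.val h1
    exact ⟨rfl, eq_of_heq h2⟩
  · rintro ⟨h, rfl⟩
    obtain rfl : S.card = j := h
    rfl

lemma card_strictMono_comp_eq (x : Fin n → Bool) (j : Fin (n + 1)) (y : Fin (j : ℕ) → Bool) :
    (Finset.univ.filter fun f : Fin (j : ℕ) → Fin n => StrictMono f ∧ x ∘ f = y).card =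
      (Finset.univ.filter fun S : Finset (Fin n) => restrictSub x S = ⟨j, y⟩).card := by
  refine Finset.card_bij (fun f _ => Finset.univ.image f) ?_ ?_ ?_
  · intro f hf
    obtain ⟨hf, hy⟩ := (Finset.mem_filter.1 hf).2
    refine Finset.mem_filter.2 ⟨Finset.mem_univ _, (restrictSub_eq_iff _ _ _ _).2
      ⟨card_image_strictMono hf, ?_⟩⟩
    rw [orderEmbOfFin_image hf, hy]
  · intro f hf g hg hfg
    have hf := ((Finset.mem_filter.1 hf).2).1
    have hg := ((Finset.mem_filter.1 hg).2).1
    have := congrArg (fun S : Finset (Fin n) => (S : Set (Fin n))) hfg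
    simp only [Finset.coe_image, Finset.coe_univ, Set.image_univ] at this
    exact (hf.range_inj hg).1 this
  · intro S hS
    obtain ⟨h, hy⟩ := (restrictSub_eq_iff _ _ _ _).1 (Finset.mem_filter.1 hS).2
    exact ⟨S.orderEmbOfFin h, Finset.mem_filter.2
      ⟨Finset.mem_univ _, (S.orderEmbOfFin h).strictMono, hy⟩, Finset.image_orderEmbOfFin_univ S h⟩

lemma card_filter_strictMono (n k : ℕ) :
    (Finset.univ.filter fun f : Fin k → Fin n => StrictMono f).card = n.choose k := by
  rw [← Finset.card_fin n, ← Finset.card_powersetCard, Finset.card_fin]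
  refine Finset.card_bij (fun f _ => Finset.univ.image f) ?_ ?_ ?_
  · intro f hf
    exact Finset.mem_powersetCard.2
      ⟨Finset.subset_univ _, card_image_strictMono (Finset.mem_filter.1 hf).2⟩
  · intro f hf g hg hfg
    have := congrArg (fun S : Finset (Fin n) => (S : Set (Fin n))) hfg
    simp only [Finset.coe_image, Finset.coe_univ, Set.image_univ] at this
    exact ((Finset.mem_filter.1 hf).2.range_inj (Finset.mem_filter.1 hg).2).1 this
  · intro S hS
    have h := (Finset.mem_powersetCard.1 hS).2
    exact ⟨S.orderEmbOfFin h, Finset.mem_filter.2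
      ⟨Finset.mem_univ _, (S.orderEmbOfFin h).strictMono⟩, Finset.image_orderEmbOfFin_univ S h⟩

lemma isChannel_exactW (hk : k ≤ n) : IsChannel (exactW (n := n) (k := k)) := by
  refine fun x => ⟨fun y => by unfold exactW; positivity, ?_⟩
  have hc : (n.choose k : ℝ) ≠ 0 := by exact_mod_cast (Nat.choose_pos hk).ne'
  simp only [exactW, ← Finset.sum_div]
  rw [div_eq_one_iff_eq hc, ← card_filter_strictMono n k, ← Nat.cast_sum,
    Finset.card_eq_sum_card_fiberwise (f := fun f => x ∘ f) (t := Finset.univ)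
      (fun _ _ => Finset.mem_coe.2 (Finset.mem_univ _))]
  simp only [Finset.filter_filter]

lemma range_eq_insert_succAbove {α : Type*} (f : Fin (k + 1) → α) (i : Fin (k + 1)) :
    Set.range f = insert (f i) (Set.range (f ∘ i.succAbove)) := by
  ext a
  simp [Fin.exists_iff_succAbove i, eq_comm]

/-- Each increasing `k`-tuple arises in `n - k` ways from an increasing `(k + 1)`-tuple by
omitting one entry. -/
lemma sum_card_strictMono_succAbove (x : Fin n → Bool) (z : Fin k → Bool) :
    ∑ i : Fin (k + 1), (Finset.univ.filter fun f : Fin (k + 1) → Fin n =>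
        StrictMono f ∧ x ∘ f ∘ i.succAbove = z).card =
      (n - k) * (Finset.univ.filter fun g : Fin k → Fin n => StrictMono g ∧ x ∘ g = z).card := by
  have hright : (n - k) * (Finset.univ.filter fun g : Fin k → Fin n =>
      StrictMono g ∧ x ∘ g = z).card =
      ((Finset.univ.filter fun g : Fin k → Fin n => StrictMono g ∧ x ∘ g = z).sigma
        fun g => (Finset.univ.image g)ᶜ).card := by
    rw [Finset.card_sigma, mul_comm, ← smul_eq_mul, ← Finset.sum_const]
    refine Finset.sum_congr rfl fun g hg => ?_
    rw [Finset.card_compl, Fintype.card_fin, card_image_strictMono (Finset.mem_filter.1 hg).2.1]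
  rw [hright, ← Finset.card_sigma]
  refine Finset.card_bij (fun q _ => ⟨q.2 ∘ q.1.succAbove, q.2 q.1⟩) ?_ ?_ ?_
  · rintro ⟨i, f⟩ hq
    simp only [Finset.mem_sigma, Finset.mem_filter, Finset.mem_univ, true_and] at hq
    simp only [Finset.mem_sigma, Finset.mem_filter, Finset.mem_univ, true_and, Finset.mem_compl,
      Finset.mem_image, not_exists, Function.comp_apply]
    exact ⟨⟨hq.1.comp (Fin.strictMono_succAbove i), hq.2⟩,
      fun j hj => Fin.succAbove_ne i j (hq.1.injective hj)⟩
  · rintro ⟨i, f⟩ hq ⟨i', f'⟩ hq' h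
    simp only [Finset.mem_sigma, Finset.mem_filter, Finset.mem_univ, true_and] at hq hq'
    simp only [Sigma.mk.inj_iff, heq_eq_eq] at h
    have hf : f = f' := by
      rw [← hq.1.range_inj hq'.1, range_eq_insert_succAbove f i, range_eq_insert_succAbove f' i',
        h.1, h.2]
    subst hf
    rw [hq.1.injective h.2]
  · rintro ⟨g, a⟩ hq
    simp only [Finset.mem_sigma, Finset.mem_filter, Finset.mem_univ, true_and,
      Finset.mem_compl] at hq
    obtain ⟨⟨hg, hz⟩, ha⟩ := hq
    have hcard : (insert a (Finset.univ.image g)).card = k + 1 := by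
      rw [Finset.card_insert_of_notMem ha, card_image_strictMono hg]
    set f := (insert a (Finset.univ.image g)).orderEmbOfFin hcard
    have hrange : a ∈ Set.range f := by
      rw [Finset.range_orderEmbOfFin]
      exact Finset.mem_coe.2 (Finset.mem_insert_self _ _)
    obtain ⟨i, hi⟩ := hrange
    have hfg : f ∘ i.succAbove = g := by
      rw [← orderEmbOfFin_image hg (card_image_strictMono hg)]
      refine Finset.orderEmbOfFin_unique _ (fun j => ?_)
        (f.strictMono.comp (Fin.strictMono_succAbove i))
      refine (Finset.mem_insert.1 (Finset.orderEmbOfFin_mem _ hcard (i.succAbove j))).resolve_left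
        fun h => ?_
      exact Fin.succAbove_ne i j (f.injective (h.trans hi.symm))
    refine ⟨⟨i, f⟩, ?_, ?_⟩
    · simp only [Finset.mem_sigma, Finset.mem_filter, Finset.mem_univ, true_and]
      exact ⟨f.strictMono, by rw [hfg, hz]⟩
    · simp only [Sigma.mk.inj_iff, heq_eq_eq]
      exact ⟨hfg, hi⟩

/-- Deleting a uniformly random symbol from the output of `W_{n,k+1}` gives `W_{n,k}`. -/
lemma pushChannel_succAbove_exactW (hk : k < n) :
    pushChannel (fun q : (Fin (k + 1) → Bool) × Fin (k + 1) => q.1 ∘ q.2.succAbove)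
      (fun (x : Fin n → Bool) q => exactW x q.1 / ((k + 1 : ℕ) : ℝ)) = exactW := by
  classical
  funext x z
  have hc : (n.choose k : ℝ) ≠ 0 := by exact_mod_cast (Nat.choose_pos hk.le).ne'
  have hc' : (n.choose (k + 1) : ℝ) ≠ 0 := by exact_mod_cast (Nat.choose_pos hk).ne'
  have hk' : ((k + 1 : ℕ) : ℝ) ≠ 0 := by positivity
  have hfib : ∀ i : Fin (k + 1), ∑ y : Fin (k + 1) → Bool, (if y ∘ i.succAbove = z then
      (Finset.univ.filter fun f : Fin (k + 1) → Fin n => StrictMono f ∧ x ∘ f = y).card else 0) =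
      (Finset.univ.filter fun f : Fin (k + 1) → Fin n =>
        StrictMono f ∧ x ∘ f ∘ i.succAbove = z).card := by
    intro i
    rw [Finset.card_eq_sum_card_fiberwise (f := fun f => x ∘ f) (t := Finset.univ)
      (fun _ _ => Finset.mem_coe.2 (Finset.mem_univ _))]
    refine Finset.sum_congr rfl fun y _ => ?_
    rw [Finset.filter_filter]
    split_ifs with h
    · congr 1
      ext f
      simp only [Finset.mem_filter, Finset.mem_univ, true_and]
      constructor
      · rintro ⟨hf, rfl⟩
        exact ⟨⟨hf, h⟩, rfl⟩
      · rintro ⟨⟨hf, -⟩, rfl⟩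
        exact ⟨hf, rfl⟩
    · symm
      rw [Finset.card_eq_zero, Finset.filter_eq_empty_iff]
      rintro f - ⟨⟨-, hz⟩, rfl⟩
      exact h hz
  have hsum := sum_card_strictMono_succAbove x z
  simp only [← hfib] at hsum
  have hsum' : ∑ i : Fin (k + 1), ∑ y : Fin (k + 1) → Bool, (if y ∘ i.succAbove = z then
      ((Finset.univ.filter fun f : Fin (k + 1) → Fin n =>
        StrictMono f ∧ x ∘ f = y).card : ℝ) else 0) =
      ((n - k : ℕ) : ℝ) * (Finset.univ.filter fun g : Fin k → Fin n =>
        StrictMono g ∧ x ∘ g = z).card := by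
    exact_mod_cast hsum
  have hch : (n.choose (k + 1) : ℝ) * ((k + 1 : ℕ) : ℝ) = n.choose k * ((n - k : ℕ) : ℝ) := by
    exact_mod_cast Nat.choose_succ_right_eq n k
  simp only [pushChannel, exactW, Fintype.sum_prod_type_right]
  calc _ = (∑ i : Fin (k + 1), ∑ y : Fin (k + 1) → Bool, (if y ∘ i.succAbove = z then
      ((Finset.univ.filter fun f : Fin (k + 1) → Fin n =>
        StrictMono f ∧ x ∘ f = y).card : ℝ) else 0)) /
        (n.choose (k + 1) * ((k + 1 : ℕ) : ℝ)) := by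
        simp only [Finset.sum_div]
        refine Finset.sum_congr rfl fun i _ => Finset.sum_congr rfl fun y _ => ?_
        split_ifs <;> simp [div_div]
    _ = _ := by
        have hnk : ((n - k : ℕ) : ℝ) ≠ 0 := by exact_mod_cast (Nat.sub_pos_of_lt hk).ne'
        rw [hsum', hch]
        field_simp

lemma mutualInfo_exactW_le_succ {p : (Fin n → Bool) → ℝ} (hp : IsDist p) (hk : k < n) :
    mutualInfo p (exactW (k := k)) ≤ mutualInfo p (exactW (k := k + 1)) := by
  have h := mutualInfo_pushChannel_le hp
    (isChannel_uniform_right k.succ_pos (isChannel_exactW (Nat.succ_le_of_lt hk)))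
    (fun q : (Fin (k + 1) → Bool) × Fin (k + 1) => q.1 ∘ q.2.succAbove)
  rwa [pushChannel_succAbove_exactW hk, mutualInfo_uniform_right k.succ_pos] at h

lemma mutualInfo_exactW_succ_le {p : (Fin n → Bool) → ℝ} (hp : IsDist p) (hk : k < n) :
    mutualInfo p (exactW (k := k + 1)) ≤
      mutualInfo p (exactW (k := k)) + Real.logb 2 (2 * n) := by
  have hfib : ∀ z : Fin k → Bool, ((fun q : (Fin (k + 1) → Bool) × Fin (k + 1) =>
      q.1 ∘ q.2.succAbove) ⁻¹' {z}).ncard ≤ 2 * (k + 1) := by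
    intro z
    have := Set.ncard_le_ncard_of_injOn (s := (fun q : (Fin (k + 1) → Bool) × Fin (k + 1) =>
        q.1 ∘ q.2.succAbove) ⁻¹' {z}) (t := (Set.univ : Set (Bool × Fin (k + 1))))
      (fun q => (q.1 q.2, q.2)) (fun _ _ => Set.mem_univ _) ?_
    · simpa [Set.ncard_univ] using this
    · rintro ⟨y, i⟩ hy ⟨y', i'⟩ hy' h
      simp only [Prod.mk.injEq] at h
      obtain ⟨h1, rfl⟩ := h
      simp only [Set.mem_preimage, Set.mem_singleton_iff] at hy hy'
      have : y = y' := by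
        funext j
        refine Fin.succAboveCases i h1 (fun j => ?_) j
        exact congrFun (hy.trans hy'.symm) j
      rw [this]
  have h := mutualInfo_le_pushChannel_add hp
    (isChannel_uniform_right k.succ_pos (isChannel_exactW (Nat.succ_le_of_lt hk)))
    (fun q : (Fin (k + 1) → Bool) × Fin (k + 1) => q.1 ∘ q.2.succAbove)
    (M := 2 * (k + 1)) (by positivity) hfib
  rw [pushChannel_succAbove_exactW hk, mutualInfo_uniform_right k.succ_pos] at h
  refine h.trans (add_le_add_right (Real.logb_le_logb_of_le (by norm_num) (by positivity) ?_) _)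
  exact_mod_cast Nat.mul_le_mul_left 2 hk

lemma abs_mutualInfo_exactW_sub_le {p : (Fin n → Bool) → ℝ} (hp : IsDist p) {j k : ℕ}
    (hj : j ≤ n) (hk : k ≤ n) :
    |mutualInfo p (exactW (k := j)) - mutualInfo p (exactW (k := k))| ≤
      |(j : ℝ) - k| * Real.logb 2 (2 * n) := by
  have main : ∀ j k : ℕ, j ≤ k → k ≤ n →
      0 ≤ mutualInfo p (exactW (k := k)) - mutualInfo p (exactW (k := j)) ∧
      mutualInfo p (exactW (k := k)) - mutualInfo p (exactW (k := j)) ≤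
        ((k : ℝ) - j) * Real.logb 2 (2 * n) := by
    intro j k hjk
    induction k, hjk using Nat.le_induction with
    | base => simp
    | succ k hjk ih =>
      intro hk
      obtain ⟨h1, h2⟩ := ih (Nat.le_of_succ_le hk)
      have h3 := mutualInfo_exactW_le_succ hp (Nat.lt_of_succ_le hk)
      have h4 := mutualInfo_exactW_succ_le hp (Nat.lt_of_succ_le hk)
      refine ⟨by linarith, ?_⟩
      push_cast
      linarith
  rcases le_total j k with h | h
  · obtain ⟨h1, h2⟩ := main j k h hk
    have hc : (j : ℝ) ≤ k := by exact_mod_cast h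
    rwa [abs_sub_comm, abs_of_nonneg h1, abs_sub_comm, abs_of_nonneg (sub_nonneg.2 hc)]
  · obtain ⟨h1, h2⟩ := main k j h hj
    have hc : (k : ℝ) ≤ j := by exact_mod_cast h
    rwa [abs_of_nonneg h1, abs_of_nonneg (sub_nonneg.2 hc)]

end Exact

section Mixture

variable {n : ℕ}

/-- The binomial probability that exactly `j` of the `n` bits survive. -/
def survivalProb (n : ℕ) (d : ℝ) (j : ℕ) : ℝ := n.choose j * (1 - d) ^ j * d ^ (n - j)

lemma delW_mk (d : ℝ) (x : Fin n → Bool) (j : Fin (n + 1)) (y : Fin (j : ℕ) → Bool) :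
    delW d x ⟨j, y⟩ = survivalProb n d j * exactW x y := by
  have hc : (n.choose j : ℝ) ≠ 0 := by
    exact_mod_cast (Nat.choose_pos (Nat.le_of_lt_succ j.2)).ne'
  rw [exactW, card_strictMono_comp_eq, delW, ← Finset.sum_filter]
  rw [Finset.sum_congr rfl (g := fun _ => (1 - d) ^ (j : ℕ) * d ^ (n - j)), Finset.sum_const,
    nsmul_eq_mul, survivalProb]
  · field_simp
  · intro S hS
    obtain ⟨h, -⟩ := (restrictSub_eq_iff _ _ _ _).1 (Finset.mem_filter.1 hS).2
    rw [h]

lemma survivalProb_nonneg {d : ℝ} (h0 : 0 ≤ d) (h1 : d ≤ 1) (j : ℕ) :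
    0 ≤ survivalProb n d j := by
  have := sub_nonneg.2 h1
  unfold survivalProb
  positivity

lemma survivalProb_eq_eval (n : ℕ) (d : ℝ) (j : ℕ) :
    survivalProb n d j = (bernsteinPolynomial ℝ n j).eval (1 - d) := by
  simp [survivalProb, bernsteinPolynomial]

lemma sum_survivalProb (n : ℕ) (d : ℝ) :
    ∑ j : Fin (n + 1), survivalProb n d j = 1 := by
  rw [Fin.sum_univ_eq_sum_range (survivalProb n d)]
  have h := congrArg (Polynomial.eval (1 - d)) (bernsteinPolynomial.sum ℝ n)
  simpa [Polynomial.eval_finsetSum, survivalProb_eq_eval] using h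

lemma sum_survivalProb_mul_sq (n : ℕ) (d : ℝ) :
    ∑ j : Fin (n + 1), survivalProb n d j * ((j : ℝ) - n * (1 - d)) ^ 2 = n * (1 - d) * d := by
  rw [Fin.sum_univ_eq_sum_range (fun j => survivalProb n d j * ((j : ℝ) - n * (1 - d)) ^ 2)]
  have h := congrArg (Polynomial.eval (1 - d)) (bernsteinPolynomial.variance ℝ n)
  simp only [Polynomial.eval_finsetSum, Polynomial.eval_mul, Polynomial.eval_pow,
    Polynomial.eval_sub, Polynomial.eval_X, Polynomial.eval_natCast,
    Polynomial.eval_one, ← survivalProb_eq_eval, nsmul_eq_mul, sub_sub_cancel] at h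
  rw [← h]
  exact Finset.sum_congr rfl fun j _ => by ring

lemma sum_survivalProb_mul_abs_le {d : ℝ} (h0 : 0 ≤ d) (h1 : d ≤ 1) :
    ∑ j : Fin (n + 1), survivalProb n d j * |(j : ℝ) - n * (1 - d)| ≤ √n := by
  rcases n.eq_zero_or_pos with rfl | hn
  · simp
  have hs : 0 < √(n : ℝ) := Real.sqrt_pos.2 (by exact_mod_cast hn)
  have hsq : √(n : ℝ) ^ 2 = n := Real.sq_sqrt n.cast_nonneg
  have hterm : ∀ j : Fin (n + 1), survivalProb n d j * |(j : ℝ) - n * (1 - d)| * (2 * √n) ≤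
      survivalProb n d j * ((j : ℝ) - n * (1 - d)) ^ 2 + survivalProb n d j * n := by
    intro j
    have h := mul_le_mul_of_nonneg_left (two_mul_le_add_sq |(j : ℝ) - n * (1 - d)| √n)
      (survivalProb_nonneg (n := n) h0 h1 j)
    rw [sq_abs, hsq] at h
    linarith
  have hsum := Finset.sum_le_sum fun j (_ : j ∈ Finset.univ) => hterm j
  rw [← Finset.sum_mul, Finset.sum_add_distrib, sum_survivalProb_mul_sq, ← Finset.sum_mul,
    sum_survivalProb, one_mul] at hsum
  have hvar : (n : ℝ) * (1 - d) * d ≤ n := by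
    have : (1 - d) * d ≤ 1 := by nlinarith
    rw [mul_assoc]
    exact mul_le_of_le_one_right n.cast_nonneg this
  refine le_of_mul_le_mul_right (hsum.trans ?_) (mul_pos two_pos hs)
  nlinarith

lemma isChannel_delW {d : ℝ} (h0 : 0 ≤ d) (h1 : d ≤ 1) : IsChannel (delW (n := n) d) := by
  refine fun x => ⟨fun y => ?_, ?_⟩
  · obtain ⟨j, y⟩ := y
    rw [delW_mk]
    exact mul_nonneg (survivalProb_nonneg h0 h1 j)
      ((isChannel_exactW (Nat.le_of_lt_succ j.2) x).1 y)
  · rw [Fintype.sum_sigma, ← sum_survivalProb n d]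
    refine Finset.sum_congr rfl fun j _ => ?_
    simp only [delW_mk, ← Finset.mul_sum, (isChannel_exactW (Nat.le_of_lt_succ j.2) x).2, mul_one]

/-- The output length is independent of the input, so the information through the deletion channel
is the average of the information through the exact deletion channels. -/
lemma mutualInfo_delW (p : (Fin n → Bool) → ℝ) (d : ℝ) :
    mutualInfo p (delW d) =
      ∑ j : Fin (n + 1), survivalProb n d j * mutualInfo p (exactW (k := j)) := by
  simp only [mutualInfo, Fintype.sum_sigma, delW_mk]
  rw [Finset.sum_comm]
  refine Finset.sum_congr rfl fun j _ => ?_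
  rw [Finset.mul_sum]
  refine Finset.sum_congr rfl fun x _ => ?_
  rw [Finset.mul_sum]
  refine Finset.sum_congr rfl fun y _ => ?_
  rcases eq_or_ne (survivalProb n d j) 0 with h | h
  · simp [h]
  · simp only [mul_left_comm _ (survivalProb n d j), ← Finset.mul_sum, mul_div_mul_left _ _ h,
      mul_assoc]

lemma abs_mutualInfo_delW_sub_le {p : (Fin n → Bool) → ℝ} (hp : IsDist p) {k : ℕ} (hn : 0 < n)
    (hk : k ≤ n) :
    |mutualInfo p (delW (1 - (k : ℝ) / n)) - mutualInfo p (exactW (k := k))| ≤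
      √n * Real.logb 2 (2 * n) := by
  have hn' : (0 : ℝ) < n := by exact_mod_cast hn
  set d : ℝ := 1 - (k : ℝ) / n
  have hkn : (k : ℝ) / n ≤ 1 := (div_le_one hn').2 (by exact_mod_cast hk)
  have h0 : 0 ≤ d := sub_nonneg.2 hkn
  have h1 : d ≤ 1 := sub_le_self _ (by positivity)
  have hmean : (n : ℝ) * (1 - d) = k := by
    simp only [d, sub_sub_cancel]
    field_simp
  have hlog : 0 ≤ Real.logb 2 (2 * n) :=
    Real.logb_nonneg (by norm_num) (by
      have : (1 : ℝ) ≤ n := by exact_mod_cast hn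
      linarith)
  calc |mutualInfo p (delW d) - mutualInfo p (exactW (k := k))|
      = |∑ j : Fin (n + 1), survivalProb n d j *
          (mutualInfo p (exactW (k := j)) - mutualInfo p (exactW (k := k)))| := by
        simp only [mul_sub, Finset.sum_sub_distrib, ← Finset.sum_mul, sum_survivalProb, one_mul,
          mutualInfo_delW]
    _ ≤ ∑ j : Fin (n + 1), survivalProb n d j * |(j : ℝ) - n * (1 - d)| *
          Real.logb 2 (2 * n) := by
        refine (Finset.abs_sum_le_sum_abs _ _).trans (Finset.sum_le_sum fun j _ => ?_)
        rw [abs_mul, abs_of_nonneg (survivalProb_nonneg h0 h1 j), mul_assoc, hmean]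
        exact mul_le_mul_of_nonneg_left
          (abs_mutualInfo_exactW_sub_le hp (Nat.le_of_lt_succ j.2) hk)
          (survivalProb_nonneg h0 h1 j)
    _ ≤ √n * Real.logb 2 (2 * n) := by
        rw [← Finset.sum_mul]
        exact mul_le_mul_of_nonneg_right (sum_survivalProb_mul_abs_le h0 h1) hlog

end Mixture

section Concatenation

variable {m n : ℕ}

/-- The string underlying an output of the deletion channel. -/
def DelOut.toList (y : DelOut n) : List Bool := List.ofFn y.2

lemma DelOut.length_toList_le (y : DelOut n) : y.toList.length ≤ n := by
  rw [DelOut.toList, List.length_ofFn]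
  exact Nat.le_of_lt_succ y.1.2

lemma DelOut.toList_injective : Function.Injective (DelOut.toList (n := n)) := by
  rintro ⟨⟨a, ha⟩, f⟩ ⟨⟨b, hb⟩, g⟩ h
  obtain rfl : a = b := by simpa [DelOut.toList] using congrArg List.length h
  obtain rfl : f = g := List.ofFn_injective h
  rfl

/-- Concatenation of the outputs of two deletion channels. -/
def DelOut.append (y : DelOut m × DelOut n) : DelOut (m + n) :=
  ⟨⟨(y.1.toList ++ y.2.toList).length, Nat.lt_succ_of_le (by
    rw [List.length_append]
    exact add_le_add y.1.length_toList_le y.2.length_toList_le)⟩,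
    (y.1.toList ++ y.2.toList).get⟩

lemma DelOut.toList_append (y : DelOut m × DelOut n) :
    (DelOut.append y).toList = y.1.toList ++ y.2.toList :=
  List.ofFn_get _

lemma toList_restrictSub (x : Fin n → Bool) (S : Finset (Fin n)) :
    (restrictSub x S).toList = S.sort.map x := by
  rw [← Finset.listMap_orderEmbOfFin_finRange S rfl, List.map_map, ← List.ofFn_eq_map]
  rfl

/-- Pairs of subsets of the two blocks as subsets of the concatenated block. -/
def finsetAppendEquiv (m n : ℕ) : Finset (Fin m) × Finset (Fin n) ≃ Finset (Fin (m + n)) :=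
  Finset.sumEquiv.symm.toEquiv.trans finSumFinEquiv.finsetCongr

lemma card_finsetAppendEquiv (S : Finset (Fin m) × Finset (Fin n)) :
    (finsetAppendEquiv m n S).card = S.1.card + S.2.card := by
  simp [finsetAppendEquiv]

lemma sort_finsetAppendEquiv (S : Finset (Fin m) × Finset (Fin n)) :
    (finsetAppendEquiv m n S).sort =
      S.1.sort.map (Fin.castAdd n) ++ S.2.sort.map (Fin.natAdd m) := by
  have hsorted : (S.1.sort.map (Fin.castAdd n) ++ S.2.sort.map (Fin.natAdd m)).Pairwise
      (· < ·) := by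
    rw [List.pairwise_append]
    refine ⟨List.pairwise_map.2 ?_, List.pairwise_map.2 ?_, ?_⟩
    · exact (Finset.sortedLT_sort S.1).pairwise.imp fun h => Fin.strictMono_castAdd n h
    · exact (Finset.sortedLT_sort S.2).pairwise.imp fun h => Fin.strictMono_natAdd m h
    · intro a ha b hb
      obtain ⟨a, -, rfl⟩ := List.mem_map.1 ha
      obtain ⟨b, -, rfl⟩ := List.mem_map.1 hb
      rw [Fin.lt_def, Fin.val_castAdd, Fin.val_natAdd]
      omega
  refine List.Perm.eq_of_pairwise' (r := (· ≤ ·)) (Finset.pairwise_sort _ _)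
    (hsorted.imp le_of_lt) ?_
  rw [List.perm_ext_iff_of_nodup (Finset.sort_nodup _ _) (hsorted.imp ne_of_lt)]
  have hne : ∀ (a : Fin m) (b : Fin n), Fin.castAdd n a ≠ Fin.natAdd m b := by
    intro a b h
    have := congrArg Fin.val h
    rw [Fin.val_castAdd, Fin.val_natAdd] at this
    omega
  intro a
  refine Fin.addCases (fun i => ?_) (fun i => ?_) a <;>
    simp [finsetAppendEquiv, Finset.mem_map_equiv, hne, (hne _ _).symm]

lemma restrictSub_append (x : (Fin m → Bool) × (Fin n → Bool))
    (S : Finset (Fin m) × Finset (Fin n)) :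
    restrictSub (Fin.append x.1 x.2) (finsetAppendEquiv m n S) =
      DelOut.append (restrictSub x.1 S.1, restrictSub x.2 S.2) := by
  apply DelOut.toList_injective
  rw [DelOut.toList_append, toList_restrictSub, toList_restrictSub, toList_restrictSub,
    sort_finsetAppendEquiv, List.map_append, List.map_map, List.map_map]
  congr 2 <;> funext i <;> simp

lemma delW_eq_sum (d : ℝ) (x : Fin n → Bool) (y : DelOut n) :
    delW d x y = ∑ S : Finset (Fin n),
      ((1 - d) ^ S.card * d ^ (n - S.card)) * if restrictSub x S = y then 1 else 0 := by
  simp [delW]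

lemma delW_append (d : ℝ) (x : (Fin m → Bool) × (Fin n → Bool)) :
    delW d (Fin.append x.1 x.2) = pushChannel DelOut.append (prodChannel (delW d) (delW d)) x := by
  classical
  funext y
  have hpush : pushChannel DelOut.append (prodChannel (delW d) (delW d)) x y =
      ∑ S : Finset (Fin m) × Finset (Fin n),
        (((1 - d) ^ S.1.card * d ^ (m - S.1.card)) * ((1 - d) ^ S.2.card * d ^ (n - S.2.card))) *
          if DelOut.append (restrictSub x.1 S.1, restrictSub x.2 S.2) = y then 1 else 0 := by
    calc _ = ∑ z, ∑ S : Finset (Fin m) × Finset (Fin n),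
          (((1 - d) ^ S.1.card * d ^ (m - S.1.card)) *
            ((1 - d) ^ S.2.card * d ^ (n - S.2.card))) *
          if (restrictSub x.1 S.1, restrictSub x.2 S.2) = z then
            (if DelOut.append z = y then 1 else 0) else 0 := by
          refine Finset.sum_congr rfl fun z _ => ?_
          simp only [prodChannel, delW_eq_sum, Finset.sum_mul_sum, ← Fintype.sum_prod_type']
          split_ifs with h
          · refine Finset.sum_congr rfl fun S _ => ?_
            rw [mul_mul_mul_comm]
            congr 1
            rw [ite_mul, one_mul, zero_mul, ← ite_and]
            simp only [Prod.ext_iff]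
          · simp
      _ = _ := by
          rw [Finset.sum_comm]
          refine Finset.sum_congr rfl fun S _ => ?_
          rw [← Finset.mul_sum, Finset.sum_ite_eq]
          simp
  rw [hpush, delW_eq_sum, ← Equiv.sum_comp (finsetAppendEquiv m n)]
  refine Finset.sum_congr rfl fun S _ => ?_
  rw [restrictSub_append, card_finsetAppendEquiv]
  congr 1
  have h1 : S.1.card ≤ m := by simpa using Finset.card_le_univ S.1
  have h2 : S.2.card ≤ n := by simpa using Finset.card_le_univ S.2
  rw [tsub_add_tsub_comm h1 h2 |>.symm, pow_add, pow_add]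
  ring

lemma ncard_append_fiber_le (z : DelOut (m + n)) :
    (DelOut.append (m := m) (n := n) ⁻¹' {z}).ncard ≤ m + 1 := by
  have := Set.ncard_le_ncard_of_injOn (s := DelOut.append (m := m) (n := n) ⁻¹' {z})
    (t := (Set.univ : Set (Fin (m + 1)))) (fun y => y.1.1) (fun _ _ => Set.mem_univ _) ?_
  · simpa [Set.ncard_univ] using this
  · rintro ⟨y₁, y₂⟩ hy ⟨y₁', y₂'⟩ hy' h
    have happ := congrArg DelOut.toList (hy.trans hy'.symm)
    rw [DelOut.toList_append, DelOut.toList_append] at happ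
    obtain ⟨e1, e2⟩ := List.append_inj happ (by simpa [DelOut.toList] using congrArg Fin.val h)
    exact Prod.ext (DelOut.toList_injective e1) (DelOut.toList_injective e2)

end Concatenation

section Capacity

variable {m n : ℕ} {d : ℝ}

/-- The maximal information, in bits, through the deletion channel with `n` input bits. -/
def delInfo (n : ℕ) (d : ℝ) : ℝ :=
  ⨆ p : {p : (Fin n → Bool) → ℝ // IsDist p}, mutualInfo p.1 (delW d)

instance : Nonempty (DelOut n) := ⟨restrictSub (fun _ => false) ∅⟩

lemma mutualInfo_le_delInfo (h0 : 0 ≤ d) (h1 : d ≤ 1) {p : (Fin n → Bool) → ℝ} (hp : IsDist p) :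
    mutualInfo p (delW d) ≤ delInfo n d :=
  le_ciSup (bddAbove_mutualInfo (isChannel_delW h0 h1)) ⟨p, hp⟩

lemma delInfo_nonneg (h0 : 0 ≤ d) (h1 : d ≤ 1) : 0 ≤ delInfo n d :=
  Real.iSup_nonneg fun p => mutualInfo_nonneg p.2 (isChannel_delW h0 h1)

lemma mutualInfo_delW_append (p : (Fin (m + n) → Bool) → ℝ) (d : ℝ) :
    mutualInfo p (delW d) = mutualInfo (fun x => p (Fin.appendEquiv m n x))
      (pushChannel DelOut.append (prodChannel (delW (n := m) d) (delW (n := n) d))) := by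
  rw [← mutualInfo_comp_equiv (Fin.appendEquiv m n)]
  congr 1
  funext x
  exact delW_append d x

lemma delInfo_add_le (h0 : 0 ≤ d) (h1 : d ≤ 1) :
    delInfo (m + n) d ≤ delInfo m d + delInfo n d := by
  have hm := isChannel_delW (n := m) h0 h1
  have hn := isChannel_delW (n := n) h0 h1
  have : Nonempty {p : (Fin (m + n) → Bool) → ℝ // IsDist p} := nonempty_dist
  refine ciSup_le fun p => ?_
  have hp := isDist_comp_equiv (Fin.appendEquiv m n) p.2
  rw [mutualInfo_delW_append]
  refine (mutualInfo_pushChannel_le hp (isChannel_prodChannel hm hn) _).trans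
    ((mutualInfo_prodChannel_le hp hm hn).trans (add_le_add ?_ ?_))
  · exact mutualInfo_le_delInfo h0 h1 (isDist_marginal_fst hp)
  · exact mutualInfo_le_delInfo h0 h1 (isDist_marginal_snd hp)

/-- Revealing the length of the output of the first block costs at most `log₂ (m + 1)` bits. -/
lemma delInfo_add_delInfo_le (h0 : 0 ≤ d) (h1 : d ≤ 1) :
    delInfo m d + delInfo n d ≤ delInfo (m + n) d + Real.logb 2 ((m + 1 : ℕ) : ℝ) := by
  have hm := isChannel_delW (n := m) h0 h1
  have hn := isChannel_delW (n := n) h0 h1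
  have : Nonempty {p : (Fin m → Bool) → ℝ // IsDist p} := nonempty_dist
  have : Nonempty {p : (Fin n → Bool) → ℝ // IsDist p} := nonempty_dist
  refine ciSup_add_ciSup_le fun p₁ p₂ => ?_
  have hp := isDist_prod p₁.2 p₂.2
  have hp' := isDist_comp_equiv (Fin.appendEquiv m n).symm hp
  rw [← mutualInfo_prodChannel_prod p₁.2 p₂.2 hm hn]
  refine (mutualInfo_le_pushChannel_add hp (isChannel_prodChannel hm hn) DelOut.append
    m.succ_pos ncard_append_fiber_le).trans (add_le_add_left ?_ _)
  refine le_trans (le_of_eq ?_) (mutualInfo_le_delInfo h0 h1 hp')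
  rw [mutualInfo_delW_append]
  simp only [Equiv.symm_apply_apply]

lemma delInfo_zero (h0 : 0 ≤ d) (h1 : d ≤ 1) : delInfo 0 d = 0 := by
  have h := delInfo_add_delInfo_le (m := 0) (n := 0) h0 h1
  have h' := delInfo_nonneg (n := 0) h0 h1
  simp only [add_zero, zero_add, Nat.cast_one, Real.logb_one] at h
  linarith

lemma delInfo_mul_le (h0 : 0 ≤ d) (h1 : d ≤ 1) (t : ℕ) :
    delInfo (t * n) d ≤ t * delInfo n d := by
  induction t with
  | zero => simp [delInfo_zero h0 h1]
  | succ t ih =>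
    rw [Nat.succ_mul]
    refine (delInfo_add_le h0 h1).trans ?_
    push_cast
    linarith

lemma mul_delInfo_le (h0 : 0 ≤ d) (h1 : d ≤ 1) (t : ℕ) :
    t * delInfo n d ≤ delInfo (t * n) d + t * Real.logb 2 ((n + 1 : ℕ) : ℝ) := by
  induction t with
  | zero => simp [delInfo_zero h0 h1]
  | succ t ih =>
    have h := delInfo_add_delInfo_le (m := n) (n := t * n) h0 h1
    rw [Nat.succ_mul, add_comm (t * n) n]
    rw [Nat.cast_succ, add_mul, add_mul]
    linarith

lemma Cn_eq_delInfo_div (n : ℕ) (d : ℝ) : Cn n d = delInfo n d / n := by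
  rw [Cn, delInfo, one_div, inv_mul_eq_div]

lemma Cn_nonneg (h0 : 0 ≤ d) (h1 : d ≤ 1) : 0 ≤ Cn n d := by
  rw [Cn_eq_delInfo_div]
  exact div_nonneg (delInfo_nonneg h0 h1) n.cast_nonneg

lemma Cn_le_Cn_add (h0 : 0 ≤ d) (h1 : d ≤ 1) (hm : 0 < m) (hn : 0 < n) :
    Cn n d ≤ Cn m d + Real.logb 2 ((n + 1 : ℕ) : ℝ) / n := by
  have hm' : (0 : ℝ) < m := by exact_mod_cast hm
  have hn' : (0 : ℝ) < n := by exact_mod_cast hn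
  have hlower := mul_delInfo_le (n := n) h0 h1 m
  have hupper := delInfo_mul_le (n := m) h0 h1 n
  rw [mul_comm n m] at hupper
  rw [Cn_eq_delInfo_div, Cn_eq_delInfo_div, div_add_div _ _ hm'.ne' hn'.ne',
    div_le_div_iff₀ hn' (mul_pos hm' hn')]
  nlinarith

lemma C_le_Cn (h0 : 0 ≤ d) (h1 : d ≤ 1) (hn : 0 < n) : C d ≤ Cn n d :=
  ciInf_le ⟨0, Set.forall_mem_range.2 fun _ => Cn_nonneg h0 h1⟩
    (⟨n, hn⟩ : {m : ℕ // 1 ≤ m})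

/-- The finite-length capacity approaches the capacity uniformly in the deletion probability. -/
lemma Cn_le_C_add (h0 : 0 ≤ d) (h1 : d ≤ 1) (hn : 0 < n) :
    Cn n d ≤ C d + Real.logb 2 ((n + 1 : ℕ) : ℝ) / n := by
  have : Nonempty {m : ℕ // 1 ≤ m} := ⟨⟨1, le_rfl⟩⟩
  rw [← sub_le_iff_le_add]
  exact le_ciInf fun m => sub_le_iff_le_add.2 (Cn_le_Cn_add h0 h1 m.2 hn)

lemma abs_Cnk_sub_Cn_le {k : ℕ} (hn : 0 < n) (hk : k ≤ n) :
    |Cnk n k - Cn n (1 - (k : ℝ) / n)| ≤ √n * Real.logb 2 (2 * n) / n := by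
  have hn' : (0 : ℝ) < n := by exact_mod_cast hn
  have h0 : 0 ≤ 1 - (k : ℝ) / n :=
    sub_nonneg.2 ((div_le_one hn').2 (by exact_mod_cast hk))
  have h1 : 1 - (k : ℝ) / n ≤ 1 := sub_le_self _ (by positivity)
  have : Nonempty {p : (Fin n → Bool) → ℝ // IsDist p} := nonempty_dist
  rw [Cn_eq_delInfo_div, Cnk, one_div, inv_mul_eq_div, ← sub_div, abs_div, abs_of_pos hn']
  refine div_le_div_of_nonneg_right (abs_sub_le_iff.2 ⟨?_, ?_⟩) hn'.le
  · refine sub_le_iff_le_add.2 (ciSup_le fun p => ?_)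
    have h := (abs_sub_le_iff.1 (abs_mutualInfo_delW_sub_le p.2 hn hk)).2
    have h' := mutualInfo_le_delInfo h0 h1 p.2
    linarith
  · refine sub_le_iff_le_add.2 (ciSup_le fun p => ?_)
    have h := (abs_sub_le_iff.1 (abs_mutualInfo_delW_sub_le p.2 hn hk)).1
    have h' := le_ciSup (bddAbove_mutualInfo (isChannel_exactW hk)) p
    linarith

lemma abs_Cnk_sub_C_le {k : ℕ} (hn : 0 < n) (hk : k ≤ n) :
    |Cnk n k - C (1 - (k : ℝ) / n)| ≤ 2 * (Real.logb 2 (2 * n) / √n) := by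
  have hn' : (0 : ℝ) < n := by exact_mod_cast hn
  have hn1 : (1 : ℝ) ≤ n := by exact_mod_cast hn
  have h0 : 0 ≤ 1 - (k : ℝ) / n :=
    sub_nonneg.2 ((div_le_one hn').2 (by exact_mod_cast hk))
  have h1 : 1 - (k : ℝ) / n ≤ 1 := sub_le_self _ (by positivity)
  have hsq : √(n : ℝ) * √n = n := Real.mul_self_sqrt hn'.le
  have hs : 0 < √(n : ℝ) := Real.sqrt_pos.2 hn'
  have hlog0 : 0 ≤ Real.logb 2 (2 * (n : ℝ)) := Real.logb_nonneg (by norm_num) (by linarith)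
  have hexact : √n * Real.logb 2 (2 * n) / n = Real.logb 2 (2 * n) / √n := by
    rw [div_eq_div_iff hn'.ne' hs.ne', mul_right_comm, hsq, mul_comm]
  have hlength : Real.logb 2 ((n + 1 : ℕ) : ℝ) / n ≤ Real.logb 2 (2 * n) / √n := by
    refine div_le_div₀ hlog0 (Real.logb_le_logb_of_le (by norm_num) (by positivity) ?_) hs
      (Real.sqrt_le_iff.2 ⟨hn'.le, le_self_pow₀ hn1 two_ne_zero⟩)
    push_cast
    linarith
  have hdiff := abs_Cnk_sub_Cn_le hn hk
  rw [hexact, abs_sub_le_iff] at hdiff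
  have hle := C_le_Cn h0 h1 hn
  have hge := Cn_le_C_add h0 h1 hn
  rw [abs_sub_le_iff]
  constructor <;> linarith [hdiff.1, hdiff.2, div_nonneg hlog0 hs.le]

lemma tendsto_logb_div_sqrt :
    Filter.Tendsto (fun n : ℕ => 2 * (Real.logb 2 (2 * (n : ℝ)) / √n)) Filter.atTop (nhds 0) := by
  have hlog : Filter.Tendsto (fun x : ℝ => Real.log x / √x) Filter.atTop (nhds 0) := by
    have h := (isLittleO_log_rpow_atTop (r := 1 / 2) (by norm_num)).tendsto_div_nhds_zero
    simpa only [Real.sqrt_eq_rpow] using h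
  have h2n : Filter.Tendsto (fun n : ℕ => 2 * (n : ℝ)) Filter.atTop Filter.atTop :=
    tendsto_natCast_atTop_atTop.const_mul_atTop two_pos
  have h := (hlog.comp h2n).const_mul (2 * √2 / Real.log 2)
  rw [mul_zero] at h
  refine h.congr fun n => ?_
  have hs : √(2 : ℝ) ≠ 0 := by positivity
  simp only [Function.comp_apply, Real.logb]
  rw [Real.sqrt_mul zero_le_two]
  field_simp

end Capacity

/-- For every `β > 0` there is an `n̄ = n̄(β)` such that for every `n ≥ n̄`
and every `1 ≤ k ≤ n`, `|C_{n,k} − C(1 − k/n)| < β`. -/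
theorem Cnk_close_to_C (β : ℝ) (hβ : 0 < β) :
    ∃ nbar : ℕ, ∀ n : ℕ, nbar ≤ n → ∀ k : ℕ, 1 ≤ k → k ≤ n →
      |Cnk n k - C (1 - (k : ℝ) / n)| < β := by
  obtain ⟨N, hN⟩ := Filter.eventually_atTop.1
    (tendsto_logb_div_sqrt.eventually (gt_mem_nhds hβ))
  refine ⟨N, fun n hn k hk hkn => ?_⟩
  exact (abs_Cnk_sub_C_le (hk.trans hkn) hkn).trans_lt (hN n hn)
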